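/- Let Ω ⊆ R^n be open and bounded and E ⊆ Sym(n)\{0} with dim span E = n. There exists u ∈ W_0^{1,∞}(Ω; R^n) with Du + (Du)^T ∈ E a.e. and ∫_Ω u ≠ 0 if and only if 0 ∈ ri(co E) and there exists a nonzero b ∈ R^n with Ab = 0 for all A ∈ (span E)^⊥. -/

import Mathlib

noncomputable section
open Matrix MeasureTheory

/-- The Frobenius inner product of two matrices. -/
def frob {m n : ℕ} (A B : Matrix (Fin m) (Fin n) ℝ) : ℝ := (Aᵀ * B).trace

/-- The (a.e. defined) Jacobian matrix of `u : ℝⁿ → ℝᵐ`. -/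
def jac {m n : ℕ} (u : (Fin n → ℝ) → (Fin m → ℝ)) (x : Fin n → ℝ) :
    Matrix (Fin m) (Fin n) ℝ :=
  Matrix.of fun i j => fderiv ℝ u x (Pi.single j 1) i

open scoped NNReal Topology

/-- The derivative of a Lipschitz map vanishes almost everywhere on a closed set where the map
vanishes. -/
lemma LipschitzWith.ae_fderiv_eq_zero_of_eqOn_zero {n : ℕ}
    {u : (Fin n → ℝ) → (Fin n → ℝ)} {C : ℝ≥0}
    (hu : LipschitzWith C u) {s : Set (Fin n → ℝ)} (hs : MeasurableSet s)
    (h0 : ∀ x ∈ s, u x = 0) :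
    ∀ᵐ x ∂(volume : Measure (Fin n → ℝ)), x ∈ s → fderiv ℝ u x = 0 := by
  set D : Set (Fin n → ℝ) := {x | DifferentiableAt ℝ u x}
  have hD : MeasurableSet D := measurableSet_of_differentiableAt ℝ u
  have happ : ApproximatesLinearOn u (0 : (Fin n → ℝ) →L[ℝ] (Fin n → ℝ)) (s ∩ D) 0 := by
    intro x hx y hy
    simp [h0 x hx.1, h0 y hy.1]
  have h1 := happ.norm_fderiv_sub_le (μ := volume) (hs.inter hD) (fderiv ℝ u)
    (fun x hx => (show DifferentiableAt ℝ u x from hx.2).hasFDerivAt.hasFDerivWithinAt)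
  rw [ae_restrict_iff' (hs.inter hD)] at h1
  filter_upwards [h1, hu.ae_differentiableAt] with x hx hd hxs
  simpa using hx ⟨hxs, hd⟩

lemma ae_jac_eq_lineDeriv {n : ℕ} {u : (Fin n → ℝ) → (Fin n → ℝ)} {C : ℝ≥0}
    (hu : LipschitzWith C u) :
    ∀ᵐ x ∂(volume : Measure (Fin n → ℝ)), ∀ i j,
      jac u x i j = lineDeriv ℝ (fun y => u y i) x (Pi.single j 1) := by
  filter_upwards [hu.ae_differentiableAt] with x hx i j
  have h := (hasFDerivAt_pi'.1 hx.hasFDerivAt) i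
  rw [h.differentiableAt.lineDeriv_eq_fderiv, h.fderiv]
  simp [jac]

lemma LipschitzWith.apply_coord {n : ℕ} {u : (Fin n → ℝ) → (Fin n → ℝ)} {C : ℝ≥0}
    (hu : LipschitzWith C u) (i : Fin n) : LipschitzWith C (fun y => u y i) := by
  simpa [Function.comp_def] using (LipschitzWith.eval (α := fun _ : Fin n => ℝ) i).comp hu

lemma lineDeriv_eq_zero_of_notMem_tsupport {n : ℕ} {g : (Fin n → ℝ) → ℝ} {x : Fin n → ℝ}
    (hx : x ∉ tsupport g) (v : Fin n → ℝ) : lineDeriv ℝ g x v = 0 := by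
  have h : g =ᶠ[𝓝 x] fun _ => 0 := notMem_tsupport_iff_eventuallyEq.1 hx
  rw [h.lineDeriv_eq]
  simp [lineDeriv]

lemma integrable_mul_lineDeriv {n : ℕ} {f g : (Fin n → ℝ) → ℝ} {C : ℝ≥0}
    (hf : Continuous f) (hg : LipschitzWith C g) (hc : HasCompactSupport g) (v : Fin n → ℝ) :
    Integrable (fun x => f x * lineDeriv ℝ g x v) := by
  have h := (hg.locallyIntegrable_lineDeriv (μ := volume) v).integrableOn_isCompact hc
  have h2 := h.continuousOn_mul hf.continuousOn hc
  refine (integrableOn_iff_integrable_of_support_subset ?_).1 h2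
  intro x hx
  by_contra hx'
  exact hx (by simp [lineDeriv_eq_zero_of_notMem_tsupport hx'])

lemma frob_add_transpose {n : ℕ} {A : Matrix (Fin n) (Fin n) ℝ} (hA : A.IsSymm)
    (J : Matrix (Fin n) (Fin n) ℝ) :
    frob A (J + Jᵀ) = 2 * ∑ i, ∑ j, A i j * J i j := by
  have h1 : frob A J = ∑ i, ∑ j, A i j * J i j := by
    simp only [frob, Matrix.trace, Matrix.diag, Matrix.mul_apply, Matrix.transpose_apply]
    exact Finset.sum_comm
  have h2 : frob A Jᵀ = frob A J := by
    unfold frob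
    rw [← Matrix.trace_transpose, Matrix.transpose_mul, Matrix.transpose_transpose,
      Matrix.transpose_transpose, Matrix.trace_mul_comm, hA.eq]
  have h3 : frob A (J + Jᵀ) = frob A J + frob A Jᵀ := by
    simp [frob, Matrix.mul_add, Matrix.trace_add]
  rw [h3, h2, h1]; ring

/-- Weighted integration by parts for the symmetrised gradient tested against a symmetric matrix. -/
lemma integral_mul_frob_symmGrad {n : ℕ} {u : (Fin n → ℝ) → (Fin n → ℝ)} {C D : ℝ≥0}
    (hu : LipschitzWith C u) (hc : HasCompactSupport u) {f : (Fin n → ℝ) → ℝ}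
    (hf : LipschitzWith D f) {A : Matrix (Fin n) (Fin n) ℝ} (hA : A.IsSymm) :
    Integrable (fun x => f x * frob A (jac u x + (jac u x)ᵀ)) ∧
    ∫ x, f x * frob A (jac u x + (jac u x)ᵀ) =
      -2 * ∑ i, ∑ j, A i j * ∫ x, lineDeriv ℝ f x (Pi.single j 1) * u x i := by
  have hci : ∀ i, HasCompactSupport (fun y => u y i) := fun i =>
    hc.comp_left (g := fun z : Fin n → ℝ => z i) rfl
  have hae : (fun x => f x * frob A (jac u x + (jac u x)ᵀ)) =ᵐ[volume]
      fun x => ∑ i, ∑ j, (2 * A i j) *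
        (f x * lineDeriv ℝ (fun y => u y i) x (Pi.single j 1)) := by
    filter_upwards [ae_jac_eq_lineDeriv hu] with x hx
    rw [frob_add_transpose hA]
    simp only [hx, Finset.mul_sum]
    refine Finset.sum_congr rfl fun i _ => Finset.sum_congr rfl fun j _ => ?_
    ring
  have hint : ∀ i j, Integrable (fun x => (2 * A i j) *
      (f x * lineDeriv ℝ (fun y => u y i) x (Pi.single j 1))) := fun i j =>
    (integrable_mul_lineDeriv hf.continuous (hu.apply_coord i) (hci i) _).const_mul _
  refine ⟨(integrable_finsetSum _ fun i _ => integrable_finsetSum _ fun j _ =>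
    hint i j).congr hae.symm, ?_⟩
  rw [integral_congr_ae hae, integral_finsetSum _ fun i _ =>
    integrable_finsetSum _ fun j _ => hint i j, Finset.mul_sum]
  refine Finset.sum_congr rfl fun i _ => ?_
  rw [integral_finsetSum _ fun j _ => hint i j, Finset.mul_sum]
  refine Finset.sum_congr rfl fun j _ => ?_
  have hparts := LipschitzWith.integral_lineDeriv_mul_eq (μ := volume) hf (hu.apply_coord i)
    (hci i) (Pi.single j 1)
  rw [hparts, integral_const_mul]
  simp only [lineDeriv_neg, neg_mul, integral_neg]
  simp only [mul_comm (f _)]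
  ring

lemma integral_frob_symmGrad {n : ℕ} {u : (Fin n → ℝ) → (Fin n → ℝ)} {C : ℝ≥0}
    (hu : LipschitzWith C u) (hc : HasCompactSupport u)
    {A : Matrix (Fin n) (Fin n) ℝ} (hA : A.IsSymm) :
    Integrable (fun x => frob A (jac u x + (jac u x)ᵀ)) ∧
    ∫ x, frob A (jac u x + (jac u x)ᵀ) = 0 := by
  have h := integral_mul_frob_symmGrad hu hc (LipschitzWith.const (1 : ℝ)) hA
  simpa [lineDeriv] using h

/-- If a symmetric matrix annihilates the symmetrised gradient of a compactly supported Lipschitz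
field, then it annihilates the mean of the field. -/
lemma mulVec_integral_eq_zero {n : ℕ} {u : (Fin n → ℝ) → (Fin n → ℝ)} {C : ℝ≥0}
    (hu : LipschitzWith C u) (hc : HasCompactSupport u)
    {A : Matrix (Fin n) (Fin n) ℝ} (hA : A.IsSymm)
    (h0 : ∀ᵐ x ∂(volume : Measure (Fin n → ℝ)), frob A (jac u x + (jac u x)ᵀ) = 0) :
    A.mulVec (∫ x, u x) = 0 := by
  funext k
  have h := (integral_mul_frob_symmGrad hu hc
    (LipschitzWith.eval (α := fun _ : Fin n => ℝ) k) hA).2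
  have hz : ∫ x : Fin n → ℝ, Function.eval k x * frob A (jac u x + (jac u x)ᵀ) = 0 := by
    rw [integral_congr_ae (g := fun _ => (0 : ℝ)), integral_zero]
    filter_upwards [h0] with x hx
    rw [hx, mul_zero]
  have hd : ∀ (x : Fin n → ℝ) (j : Fin n),
      lineDeriv ℝ (Function.eval k : (Fin n → ℝ) → ℝ) x (Pi.single j 1)
        = if k = j then 1 else 0 := by
    intro x j
    have : HasFDerivAt (Function.eval k : (Fin n → ℝ) → ℝ)
        (ContinuousLinearMap.proj (R := ℝ) (φ := fun _ : Fin n => ℝ) k) x :=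
      (ContinuousLinearMap.proj (R := ℝ) (φ := fun _ : Fin n => ℝ) k).hasFDerivAt
    rw [this.differentiableAt.lineDeriv_eq_fderiv, this.fderiv]
    simp [Pi.single_apply]
  have hui : Integrable u := hu.continuous.integrable_of_hasCompactSupport hc
  rw [hz] at h
  simp only [hd, ite_mul, one_mul, zero_mul] at h
  have h3 : ∑ i, A i k * ∫ x, u x i = 0 := by
    have h4 : ∀ i, ∑ j, A i j * ∫ x, (if k = j then u x i else 0) = A i k * ∫ x, u x i := by
      intro i
      rw [Finset.sum_eq_single k]
      · simp
      · intro j _ hj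
        simp [Ne.symm hj]
      · simp
    simp only [h4] at h
    linarith
  simp only [Matrix.mulVec, dotProduct, Pi.zero_apply]
  rw [← h3]
  refine Finset.sum_congr rfl fun i _ => ?_
  rw [hA.apply i k, eval_integral fun i => hui.eval i]

/-- The linear map `a ↦ a ⊗ b + b ⊗ a`. -/
def symmOuter {n : ℕ} (b : Fin n → ℝ) : (Fin n → ℝ) →ₗ[ℝ] Matrix (Fin n) (Fin n) ℝ where
  toFun a := Matrix.vecMulVec b a + (Matrix.vecMulVec b a)ᵀ
  map_add' x y := by
    ext i j
    simp [Matrix.vecMulVec_apply]; ring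
  map_smul' c x := by
    ext i j
    simp [Matrix.vecMulVec_apply]; ring

lemma symmOuter_apply {n : ℕ} (b a : Fin n → ℝ) :
    symmOuter b a = Matrix.vecMulVec b a + (Matrix.vecMulVec b a)ᵀ := rfl

lemma symmOuter_isSymm {n : ℕ} (b a : Fin n → ℝ) : (symmOuter b a).IsSymm := by
  rw [symmOuter_apply, Matrix.IsSymm, Matrix.transpose_add, Matrix.transpose_transpose, add_comm]

lemma frob_symmOuter {n : ℕ} {A : Matrix (Fin n) (Fin n) ℝ} (hA : A.IsSymm)
    (b a : Fin n → ℝ) : frob A (symmOuter b a) = 2 * (A.mulVec b ⬝ᵥ a) := by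
  rw [symmOuter_apply, frob_add_transpose hA]
  simp only [dotProduct, Matrix.mulVec, Matrix.vecMulVec_apply, Finset.sum_mul]
  rw [Finset.sum_comm]
  congr 1
  refine Finset.sum_congr rfl fun i _ => Finset.sum_congr rfl fun j _ => ?_
  rw [hA.apply i j]; ring

/-- Every vector is the image of a given nonzero vector under some symmetric matrix. -/
lemma exists_isSymm_mulVec_eq {n : ℕ} {b : Fin n → ℝ} (hb : b ≠ 0) (c : Fin n → ℝ) :
    ∃ A : Matrix (Fin n) (Fin n) ℝ, A.IsSymm ∧ A.mulVec b = c := by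
  have hbb : b ⬝ᵥ b ≠ 0 := fun h => hb (dotProduct_self_eq_zero.1 h)
  refine ⟨(b ⬝ᵥ b)⁻¹ • symmOuter b c - ((b ⬝ᵥ c) / (b ⬝ᵥ b) ^ 2) • Matrix.vecMulVec b b,
    ?_, ?_⟩
  · refine Matrix.IsSymm.sub ((symmOuter_isSymm b c).smul _) (Matrix.IsSymm.smul ?_ _)
    ext i j
    simp [Matrix.vecMulVec_apply, mul_comm]
  · simp only [symmOuter_apply, Matrix.sub_mulVec, Matrix.smul_mulVec, Matrix.add_mulVec,
      Matrix.transpose_vecMulVec, Matrix.vecMulVec_mulVec, dotProduct_comm c b]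
    ext i
    simp
    field_simp
    ring

lemma symmOuter_injective {n : ℕ} {b : Fin n → ℝ} (hb : b ≠ 0) :
    Function.Injective (symmOuter b) := by
  refine (injective_iff_map_eq_zero _).2 fun a ha => ?_
  obtain ⟨A, hA, hAb⟩ := exists_isSymm_mulVec_eq hb a
  have h := frob_symmOuter hA b a
  rw [ha, hAb] at h
  have h0 : frob A 0 = 0 := by simp [frob]
  rw [h0] at h
  exact dotProduct_self_eq_zero.1 (by linarith)

/-- If every symmetric matrix orthogonal to `E` annihilates `b ≠ 0` and `span E` is
`n`-dimensional, then `span E` consists of the matrices `a ⊗ b + b ⊗ a`. -/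
lemma span_eq_range_symmOuter {n : ℕ} {E : Set (Matrix (Fin n) (Fin n) ℝ)}
    (hE : ∀ A ∈ E, A.IsSymm) (hdim : Module.finrank ℝ (Submodule.span ℝ E) = n)
    {b : Fin n → ℝ} (hb : b ≠ 0)
    (hA : ∀ A : Matrix (Fin n) (Fin n) ℝ, A.IsSymm → (∀ B ∈ E, frob A B = 0) →
      A.mulVec b = 0) :
    Submodule.span ℝ E = LinearMap.range (symmOuter b) := by
  symm
  refine Submodule.eq_of_le_of_finrank_eq ?_ ?_
  · rintro _ ⟨a, rfl⟩
    by_contra hna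
    obtain ⟨φ, hφa, hφ⟩ := Submodule.exists_le_ker_of_notMem hna
    set A' : Matrix (Fin n) (Fin n) ℝ := Matrix.of fun i j => φ (Matrix.single i j 1) with hA'
    have hrep : ∀ X, φ X = ∑ i, ∑ j, A' i j * X i j := by
      intro X
      conv_lhs => rw [Matrix.matrix_eq_sum_single X]
      simp only [map_sum]
      refine Finset.sum_congr rfl fun i _ => Finset.sum_congr rfl fun j _ => ?_
      rw [show Matrix.single i j (X i j) = X i j • Matrix.single i j (1 : ℝ) by simp, map_smul]
      simp [hA', mul_comm]
    have hsym : (A' + A'ᵀ).IsSymm := Matrix.isSymm_add_transpose_self A'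
    have hfrob : ∀ X : Matrix (Fin n) (Fin n) ℝ, X.IsSymm → frob (A' + A'ᵀ) X = 2 * φ X := by
      intro X hX
      have h1 := frob_add_transpose hsym X
      have h2 : frob (A' + A'ᵀ) (X + Xᵀ) = 2 * frob (A' + A'ᵀ) X := by
        rw [hX.eq, ← two_smul ℝ X]
        simp [frob]
      have h3 : ∑ i, ∑ j, A' j i * X i j = φ X := by
        rw [hrep, Finset.sum_comm]
        refine Finset.sum_congr rfl fun i _ => Finset.sum_congr rfl fun j _ => ?_
        rw [hX.apply i j]
      simp only [Matrix.add_apply, Matrix.transpose_apply, add_mul, Finset.sum_add_distrib] at h1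
      rw [h3, ← hrep] at h1
      linarith
    have hAb := hA _ hsym fun B hB => by
      have : φ B = 0 := hφ (Submodule.subset_span hB)
      rw [hfrob B (hE B hB), this, mul_zero]
    have h4 := frob_symmOuter hsym b a
    rw [hfrob _ (symmOuter_isSymm b a), hAb, zero_dotProduct] at h4
    exact hφa (by linarith)
  · rw [hdim, LinearMap.finrank_range_of_inj (symmOuter_injective hb)]
    simp

/-- A point outside the interior of a convex hull in a finite-dimensional space is weakly separated
from the set by a nonzero functional. -/
lemma exists_ne_zero_nonpos_of_zero_notMem_interior {V : Type*} [NormedAddCommGroup V]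
    [NormedSpace ℝ V] [FiniteDimensional ℝ V] [Nontrivial V] {F : Set V}
    (h0 : (0 : V) ∉ interior (convexHull ℝ F)) :
    ∃ f : V →ₗ[ℝ] ℝ, f ≠ 0 ∧ ∀ a ∈ F, f a ≤ 0 := by
  by_cases hne : (interior (convexHull ℝ F)).Nonempty
  · obtain ⟨f, hf⟩ := geometric_hahn_banach_open_point (convex_convexHull ℝ F).interior
      isOpen_interior h0
    rw [map_zero] at hf
    refine ⟨f.toLinearMap, ?_, fun a ha => ?_⟩
    · rintro hz
      obtain ⟨y, hy⟩ := hne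
      have h1 := hf y hy
      have h2 : f.toLinearMap y = 0 := by rw [hz]; rfl
      exact h1.ne h2
    · have h1 : closure (interior (convexHull ℝ F)) ⊆ {y | f y ≤ 0} :=
        closure_minimal (fun y hy => (hf y hy).le) (isClosed_le f.continuous continuous_const)
      rw [(convex_convexHull ℝ F).closure_interior_eq_closure_of_nonempty_interior hne] at h1
      exact h1 (subset_closure (subset_convexHull ℝ F ha))
  · rw [interior_convexHull_nonempty_iff_affineSpan_eq_top] at hne
    have hlt : (affineSpan ℝ F).direction < ⊤ := by
      refine lt_top_iff_ne_top.2 fun htop => ?_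
      rcases F.eq_empty_or_nonempty with rfl | hF
      · simp at htop
      · exact hne ((AffineSubspace.direction_eq_top_iff_of_nonempty
          ((affineSpan_nonempty ℝ).2 hF)).1 htop)
    obtain ⟨f, hf0, hf⟩ := Submodule.exists_le_ker_of_lt_top _ hlt
    rcases F.eq_empty_or_nonempty with rfl | ⟨p, hp⟩
    · exact ⟨f, hf0, by simp⟩
    have hconst : ∀ a ∈ F, f a = f p := by
      intro a ha
      have : a - p ∈ (affineSpan ℝ F).direction :=
        AffineSubspace.vsub_mem_direction (mem_affineSpan ℝ ha) (mem_affineSpan ℝ hp)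
      have h := hf this
      rw [LinearMap.mem_ker, map_sub, sub_eq_zero] at h
      exact h
    rcases le_total (f p) 0 with h | h
    · exact ⟨f, hf0, fun a ha => (hconst a ha).trans_le h⟩
    · exact ⟨-f, neg_ne_zero.2 hf0, fun a ha => by
        simpa [hconst a ha] using h⟩

/-- Under an injective linear map between finite-dimensional spaces, the origin is interior to a
hull exactly when it is relatively interior to the hull of the image, provided the set spans. -/
lemma zero_mem_intrinsicInterior_image_iff {n : ℕ} {W : Type*} [AddCommGroup W] [Module ℝ W]
    [TopologicalSpace W] [IsTopologicalAddGroup W] [ContinuousSMul ℝ W] [T2Space W]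
    [FiniteDimensional ℝ W] {L : (Fin n → ℝ) →ₗ[ℝ] W} (hL : Function.Injective L)
    {F : Set (Fin n → ℝ)} (hF : Submodule.span ℝ F = ⊤) :
    (0 : W) ∈ intrinsicInterior ℝ (convexHull ℝ (L '' F)) ↔
      (0 : Fin n → ℝ) ∈ interior (convexHull ℝ F) := by
  have hLc : Continuous L := L.continuous_of_finiteDimensional
  rw [mem_intrinsicInterior, ← L.image_convexHull]
  constructor
  · rintro ⟨y, hy, hy0⟩
    obtain ⟨O, hO, hOo, hyO⟩ := mem_interior.1 hy
    obtain ⟨O', hO', rfl⟩ := isOpen_induced_iff.1 hOo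
    have h0 : (0 : W) ∈ L '' convexHull ℝ F := by
      have := interior_subset hy
      rwa [Set.mem_preimage, hy0] at this
    have hspan : (affineSpan ℝ (L '' convexHull ℝ F) : Set W)
        = Submodule.span ℝ (L '' convexHull ℝ F) := by
      rw [← affineSpan_insert_zero, Set.insert_eq_of_mem h0]
    refine mem_interior.2 ⟨L ⁻¹' O', fun a ha => ?_, hO'.preimage hLc, ?_⟩
    · have haS : L a ∈ affineSpan ℝ (L '' convexHull ℝ F) := by
        rw [← SetLike.mem_coe, hspan, SetLike.mem_coe, Submodule.span_image]
        refine Submodule.mem_map_of_mem ?_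
        have := Submodule.span_mono (R := ℝ) (subset_convexHull ℝ F)
        rw [hF] at this
        exact this trivial
      obtain ⟨a', ha', he⟩ := hO (show (⟨L a, haS⟩ : affineSpan ℝ (L '' convexHull ℝ F)) ∈
        Subtype.val ⁻¹' O' from ha)
      rwa [← hL he]
    · rw [Set.mem_preimage, map_zero]
      rwa [Set.mem_preimage, hy0] at hyO
  · intro h
    obtain ⟨M, hM⟩ := LinearMap.exists_leftInverse_of_injective L (LinearMap.ker_eq_bot.2 hL)
    have hMc : Continuous M := M.continuous_of_finiteDimensional
    have hML : ∀ a, M (L a) = a := fun a => LinearMap.congr_fun hM a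
    have h0 : (0 : W) ∈ affineSpan ℝ (L '' convexHull ℝ F) :=
      mem_affineSpan ℝ ⟨0, interior_subset h, map_zero L⟩
    refine ⟨⟨0, h0⟩, mem_interior.2 ⟨(fun z => M z.1) ⁻¹' interior (convexHull ℝ F), ?_,
      isOpen_interior.preimage (hMc.comp continuous_subtype_val), ?_⟩, rfl⟩
    · rintro ⟨z, hz⟩ hzM
      have hz' : z ∈ LinearMap.range L := by
        have h1 := affineSpan_subset_span hz
        refine (Submodule.span_le.2 ?_ : _ ≤ LinearMap.range L) h1
        rintro _ ⟨a, -, rfl⟩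
        exact ⟨a, rfl⟩
      obtain ⟨a, rfl⟩ := hz'
      have hzM' : M (L a) ∈ interior (convexHull ℝ F) := hzM
      rw [hML] at hzM'
      exact ⟨a, interior_subset hzM', rfl⟩
    · simpa using h

section Scalar

variable {V : Type*} [NormedAddCommGroup V] [NormedSpace ℝ V]

/-- The set where all the affine functions `ρ + ℓ (· - c)` are nonnegative. -/
def pyramidBase (T : Finset (V →L[ℝ] ℝ)) (p : V × ℝ) : Set V :=
  {y | ∀ ℓ ∈ T, 0 ≤ p.2 + ℓ (y - p.1)}

/-- The positive part of the minimum of the affine functions `ρ + ℓ (· - c)`. -/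
def pyramid (T : Finset (V →L[ℝ] ℝ)) (hT : T.Nonempty) (p : V × ℝ) (y : V) : ℝ :=
  max 0 (T.inf' hT fun ℓ => p.2 + ℓ (y - p.1))

variable {T : Finset (V →L[ℝ] ℝ)} {hT : T.Nonempty} {p : V × ℝ}

lemma isClosed_pyramidBase : IsClosed (pyramidBase T p) := by
  have : pyramidBase T p = ⋂ ℓ ∈ T, {y | 0 ≤ p.2 + ℓ (y - p.1)} := by
    ext y; simp [pyramidBase]
  rw [this]
  exact isClosed_biInter fun ℓ _ => isClosed_le continuous_const (by fun_prop)

lemma convex_pyramidBase : Convex ℝ (pyramidBase T p) := by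
  intro x hx y hy a b ha hb hab ℓ hℓ
  have h1 := mul_nonneg ha (hx ℓ hℓ)
  have h2 := mul_nonneg hb (hy ℓ hℓ)
  have h3 : p.2 + ℓ (a • x + b • y - p.1)
      = a * (p.2 + ℓ (x - p.1)) + b * (p.2 + ℓ (y - p.1)) := by
    simp only [map_sub, map_add, map_smul, smul_eq_mul]
    linear_combination (ℓ p.1 - p.2) * hab
  rw [h3]; positivity

lemma pyramid_nonneg (y : V) : 0 ≤ pyramid T hT p y := le_max_left _ _

lemma pyramid_of_mem {y : V} (hy : y ∈ pyramidBase T p) :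
    pyramid T hT p y = T.inf' hT fun ℓ => p.2 + ℓ (y - p.1) :=
  max_eq_right ((Finset.le_inf'_iff hT _).2 hy)

lemma pyramid_of_notMem {y : V} (hy : y ∉ pyramidBase T p) : pyramid T hT p y = 0 := by
  refine max_eq_left ?_
  by_contra! h
  exact hy ((Finset.le_inf'_iff hT _).1 h.le)

lemma pyramid_center (hp : 0 ≤ p.2) : pyramid T hT p p.1 = p.2 := by
  simp [pyramid, hp]

lemma pyramid_lipschitzWith {K : ℝ≥0} (hK : ∀ ℓ ∈ T, ‖ℓ‖ ≤ K) :
    LipschitzWith K (pyramid T hT p) := by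
  refine LipschitzWith.of_le_add_mul K fun y z => ?_
  obtain ⟨ℓ, hℓ, he⟩ := Finset.exists_mem_eq_inf' hT fun ℓ => p.2 + ℓ (z - p.1)
  have h1 : (T.inf' hT fun ℓ => p.2 + ℓ (y - p.1)) ≤ p.2 + ℓ (y - p.1) :=
    Finset.inf'_le _ hℓ
  have h2 : ℓ (y - p.1) ≤ ℓ (z - p.1) + K * dist y z := by
    have h3 : ℓ (y - p.1) - ℓ (z - p.1) = ℓ (y - z) := by
      rw [← map_sub]; congr 1; abel
    have h4 : ℓ (y - z) ≤ K * dist y z := by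
      rw [dist_eq_norm]
      exact (le_abs_self _).trans ((ℓ.le_opNorm _).trans
        (mul_le_mul_of_nonneg_right (hK ℓ hℓ) (norm_nonneg _)))
    linarith
  have h5 : 0 ≤ (K : ℝ) * dist y z := by positivity
  have h6 : p.2 + ℓ (z - p.1) ≤ pyramid T hT p z := he ▸ le_max_right _ _
  have h7 : 0 ≤ pyramid T hT p z := pyramid_nonneg z
  exact max_le (by linarith) (by linarith)

lemma pyramidBase_subset_closedBall {ε : ℝ} (hε : 0 < ε)
    (hco : ∀ x : V, ∃ ℓ ∈ T, ℓ x ≤ -ε * ‖x‖) :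
    pyramidBase T p ⊆ Metric.closedBall p.1 (p.2 / ε) := by
  intro y hy
  obtain ⟨ℓ, hℓ, h⟩ := hco (y - p.1)
  have := hy ℓ hℓ
  rw [Metric.mem_closedBall, dist_eq_norm, le_div_iff₀ hε]
  linarith

lemma closedBall_subset_pyramidBase {K : ℝ≥0} (hK : ∀ ℓ ∈ T, ‖ℓ‖ ≤ K) :
    Metric.closedBall p.1 (p.2 / (K + 1)) ⊆ pyramidBase T p := by
  intro y hy ℓ hℓ
  rw [Metric.mem_closedBall, dist_eq_norm, le_div_iff₀ (by positivity)] at hy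
  have h1 := (neg_abs_le _).trans' (neg_le_neg (ℓ.le_opNorm (y - p.1)))
  have h2 := mul_le_mul_of_nonneg_right (hK ℓ hℓ) (norm_nonneg (y - p.1))
  have h3 := norm_nonneg (y - p.1)
  nlinarith

variable [FiniteDimensional ℝ V] [MeasurableSpace V] [BorelSpace V]
  {μ : Measure V} [μ.IsAddHaarMeasure]

/-- Up to a null set, an open set is a disjoint countable union of homothetic pyramid bases. -/
lemma exists_pyramidBase_covering {Ω : Set V} (hΩ : IsOpen Ω) {ε : ℝ} (hε : 0 < ε)
    (hco : ∀ x : V, ∃ ℓ ∈ T, ℓ x ≤ -ε * ‖x‖) :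
    ∃ u : Set (V × ℝ), (∀ p ∈ u, 0 < p.2 ∧ pyramidBase T p ⊆ Ω) ∧ u.Countable ∧
      u.PairwiseDisjoint (pyramidBase T) ∧ μ (Ω \ ⋃ p ∈ u, pyramidBase T p) = 0 := by
  obtain ⟨K, hK⟩ : ∃ K : ℝ≥0, ∀ ℓ ∈ T, ‖ℓ‖ ≤ K :=
    ⟨T.sup fun ℓ => ‖ℓ‖₊, fun ℓ hℓ => by
      exact_mod_cast Finset.le_sup (f := fun ℓ : V →L[ℝ] ℝ => ‖ℓ‖₊) hℓ⟩
  set t : Set (V × ℝ) := {p | 0 < p.2 ∧ Metric.closedBall p.1 (p.2 / ε) ⊆ Ω} with ht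
  set q : ℝ := 3 * (K + 1) / ε with hq
  have hq0 : 0 ≤ q := by positivity
  obtain ⟨u, hut, huc, hud, huμ⟩ := Vitali.exists_disjoint_covering_ae μ Ω t
    (Real.toNNReal (q ^ Module.finrank ℝ V)) (fun p => p.2 / ε) Prod.fst (pyramidBase T)
    (fun p _ => pyramidBase_subset_closedBall hε hco)
    (fun p hp => by
      have hp2 : 0 < p.2 := hp.1
      have h1 : 3 * (p.2 / ε) = q * (p.2 / (K + 1)) := by
        rw [hq]; field_simp
      rw [h1, Measure.addHaar_closedBall_mul μ _ hq0 (by positivity),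
        ← Measure.addHaar_closedBall_center μ p.1]
      refine mul_le_mul_right (measure_mono ?_) _
      exact closedBall_subset_pyramidBase hK)
    (fun p hp => by
      have hp2 : 0 < p.2 := hp.1
      exact ⟨p.1, interior_mono (closedBall_subset_pyramidBase hK)
        (Metric.ball_subset_interior_closedBall (Metric.mem_ball_self (by positivity)))⟩)
    (fun p _ => isClosed_pyramidBase)
    (fun x hx η hη => by
      obtain ⟨η', hη', hsub⟩ := Metric.nhds_basis_closedBall.mem_iff.1 (hΩ.mem_nhds hx)
      refine ⟨(x, ε * min η η'), ⟨by have := lt_min hη hη'; positivity, ?_⟩, ?_, rfl⟩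
      · refine (Metric.closedBall_subset_closedBall ?_).trans hsub
        simp only [mul_div_cancel_left₀ _ hε.ne']
        exact min_le_right _ _
      · simp only [mul_div_cancel_left₀ _ hε.ne']
        exact min_le_left _ _)
  exact ⟨u, fun p hp => ⟨(hut hp).1,
    (pyramidBase_subset_closedBall hε hco).trans (hut hp).2⟩, huc, hud, huμ⟩

/-- Given finitely many gradients that are coercive, there is a nonnegative, nonzero Lipschitz
function vanishing outside a prescribed nonempty open set and having these gradients almost
everywhere inside. -/
lemma exists_lipschitz_hasFDerivAt_mem {Ω : Set V} (hΩ : IsOpen Ω) (hne : Ω.Nonempty) {ε : ℝ}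
    (hε : 0 < ε) (hco : ∀ x : V, ∃ ℓ ∈ T, ℓ x ≤ -ε * ‖x‖) :
    ∃ (v : V → ℝ) (K : ℝ≥0), LipschitzWith K v ∧ (∀ x ∉ Ω, v x = 0) ∧ 0 ≤ v ∧
      (∃ x, v x ≠ 0) ∧ ∀ᵐ x ∂μ, x ∈ Ω → ∃ ℓ ∈ T, HasFDerivAt v ℓ x := by
  classical
  obtain ⟨K, hK⟩ : ∃ K : ℝ≥0, ∀ ℓ ∈ T, ‖ℓ‖ ≤ K :=
    ⟨T.sup fun ℓ => ‖ℓ‖₊, fun ℓ hℓ => by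
      exact_mod_cast Finset.le_sup (f := fun ℓ : V →L[ℝ] ℝ => ‖ℓ‖₊) hℓ⟩
  have hT : T.Nonempty := let ⟨ℓ, hℓ, _⟩ := hco 0; ⟨ℓ, hℓ⟩
  obtain ⟨u, hu, huc, hud, huμ⟩ := exists_pyramidBase_covering (μ := μ) hΩ hε hco
  set v : V → ℝ := fun y => if h : ∃ p ∈ u, y ∈ pyramidBase T p then
    pyramid T hT h.choose y else 0 with hv
  have hv1 : ∀ p ∈ u, ∀ y ∈ pyramidBase T p, v y = pyramid T hT p y := by
    intro p hp y hy
    have h : ∃ p ∈ u, y ∈ pyramidBase T p := ⟨p, hp, hy⟩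
    have he : h.choose = p := by
      by_contra hne
      exact Set.disjoint_left.1 (hud h.choose_spec.1 hp hne) h.choose_spec.2 hy
    simp only [hv, dif_pos h, he]
  have hv0 : ∀ y, (¬ ∃ p ∈ u, y ∈ pyramidBase T p) → v y = 0 := fun y h => by
    simp only [hv, dif_neg h]
  have hnn : 0 ≤ v := by
    intro y
    by_cases h : ∃ p ∈ u, y ∈ pyramidBase T p
    · obtain ⟨p, hp, hy⟩ := h
      rw [hv1 p hp y hy]; exact pyramid_nonneg y
    · rw [hv0 y h]; rfl
  have hge : ∀ p ∈ u, ∀ z, pyramid T hT p z ≤ v z := by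
    intro p hp z
    by_cases hz : z ∈ pyramidBase T p
    · rw [hv1 p hp z hz]
    · rw [pyramid_of_notMem hz]; exact hnn z
  have hlip : LipschitzWith K v := by
    refine LipschitzWith.of_le_add_mul K fun y z => ?_
    have hz : 0 ≤ v z := hnn z
    by_cases h : ∃ p ∈ u, y ∈ pyramidBase T p
    · obtain ⟨p, hp, hy⟩ := h
      rw [hv1 p hp y hy]
      have h1 := (pyramid_lipschitzWith (hT := hT) (p := p) hK).le_add_mul y z
      linarith [hge p hp z]
    · rw [hv0 y h]; positivity
  refine ⟨v, K, hlip, ?_, hnn, ?_, ?_⟩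
  · intro x hx
    refine hv0 x ?_
    rintro ⟨p, hp, hxp⟩
    exact hx ((hu p hp).2 hxp)
  · have hune : u.Nonempty := by
      by_contra h
      rw [Set.not_nonempty_iff_eq_empty] at h
      subst h
      simp only [Set.mem_empty_iff_false, Set.iUnion_of_empty, Set.iUnion_empty,
        Set.sdiff_empty] at huμ
      exact (hΩ.measure_pos μ hne).ne' huμ
    obtain ⟨p, hp⟩ := hune
    have hp2 := (hu p hp).1
    refine ⟨p.1, ?_⟩
    have h1 := hge p hp p.1
    rw [pyramid_center hp2.le] at h1
    linarith
  · have hfr : ∀ᵐ x ∂μ, ∀ p ∈ u, x ∉ frontier (pyramidBase T p) :=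
      (ae_ball_iff huc).2 fun p _ => measure_eq_zero_iff_ae_notMem.1
        (convex_pyramidBase.addHaar_frontier μ)
    filter_upwards [measure_eq_zero_iff_ae_notMem.1 huμ, hfr, hlip.ae_differentiableAt]
      with x hx hxf hxd hxΩ
    have hx' : x ∈ ⋃ p ∈ u, pyramidBase T p := by
      by_contra h; exact hx ⟨hxΩ, h⟩
    simp only [Set.mem_iUnion, exists_prop] at hx'
    obtain ⟨p, hp, hxp⟩ := hx'
    have hint : x ∈ interior (pyramidBase T p) := by
      by_contra h
      exact hxf p hp ⟨subset_closure hxp, h⟩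
    obtain ⟨ℓ, hℓ, he⟩ := Finset.exists_mem_eq_inf' hT fun ℓ => p.2 + ℓ (x - p.1)
    refine ⟨ℓ, hℓ, ?_⟩
    have hmax : IsLocalMax (fun y => v y - ℓ y) x := by
      filter_upwards [mem_interior_iff_mem_nhds.1 hint] with y hy
      have h1 : v y ≤ p.2 + ℓ (y - p.1) := by
        rw [hv1 p hp y hy, pyramid_of_mem hy]
        exact Finset.inf'_le _ hℓ
      have h2 : v x = p.2 + ℓ (x - p.1) := by
        rw [hv1 p hp x hxp, pyramid_of_mem hxp, he]
      rw [map_sub] at h1 h2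
      linarith
    have hd := hxd.hasFDerivAt.sub ℓ.hasFDerivAt
    have h0 := hmax.hasFDerivAt_eq_zero hd
    rw [← sub_eq_zero.1 h0]
    exact hxd.hasFDerivAt

end Scalar

/-- The continuous linear functional `x ↦ a ⬝ᵥ x`. -/
def dotCLM {n : ℕ} (a : Fin n → ℝ) : (Fin n → ℝ) →L[ℝ] ℝ :=
  ∑ i, a i • ContinuousLinearMap.proj i

lemma dotCLM_apply {n : ℕ} (a x : Fin n → ℝ) : dotCLM a x = a ⬝ᵥ x := by
  simp [dotCLM, dotProduct]

lemma norm_sq_le_dotProduct_self {n : ℕ} (x : Fin n → ℝ) : ‖x‖ ^ 2 ≤ x ⬝ᵥ x := by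
  have h0 : 0 ≤ x ⬝ᵥ x := Finset.sum_nonneg fun i _ => mul_self_nonneg (x i)
  have h : ‖x‖ ≤ Real.sqrt (x ⬝ᵥ x) := by
    refine (pi_norm_le_iff_of_nonneg (Real.sqrt_nonneg _)).2 fun i => Real.abs_le_sqrt ?_
    rw [sq]
    exact Finset.single_le_sum (f := fun i => x i * x i) (fun i _ => mul_self_nonneg (x i))
      (Finset.mem_univ i)
  calc ‖x‖ ^ 2 ≤ Real.sqrt (x ⬝ᵥ x) ^ 2 := by gcongr
    _ = x ⬝ᵥ x := Real.sq_sqrt h0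

/-- An interior point of a convex hull is interior to the hull of a finite subset. -/
lemma exists_finset_mem_interior_convexHull {V : Type*} [NormedAddCommGroup V]
    [NormedSpace ℝ V] [FiniteDimensional ℝ V] {F : Set V} {x : V}
    (hx : x ∈ interior (convexHull ℝ F)) :
    ∃ T : Finset V, ↑T ⊆ F ∧ x ∈ interior (convexHull ℝ (T : Set V)) := by
  classical
  obtain ⟨b, hb, hbF⟩ := exists_mem_interior_convexHull_affineBasis (mem_interior_iff_mem_nhds.1 hx)
  have h1 : ∀ i, ∃ T : Finset V, ↑T ⊆ F ∧ b i ∈ convexHull ℝ (T : Set V) := by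
    intro i
    have h2 := hbF (subset_convexHull ℝ _ (Set.mem_range_self i))
    rw [convexHull_eq_union_convexHull_finite_subsets] at h2
    simpa using h2
  choose T hTF hT using h1
  refine ⟨Finset.univ.biUnion T, by simpa using hTF, ?_⟩
  refine interior_mono (convexHull_min ?_ (convex_convexHull ℝ _)) hb
  rintro _ ⟨i, rfl⟩
  refine convexHull_mono ?_ (hT i)
  exact_mod_cast Finset.subset_biUnion_of_mem T (Finset.mem_univ i)

lemma exists_coercive_of_zero_mem_interior {n : ℕ} {T : Set (Fin n → ℝ)}
    (h : (0 : Fin n → ℝ) ∈ interior (convexHull ℝ T)) :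
    ∃ ε > 0, ∀ x : Fin n → ℝ, ∃ a ∈ T, a ⬝ᵥ x ≤ -ε * ‖x‖ := by
  obtain ⟨r, hr, hsub⟩ := Metric.nhds_basis_closedBall.mem_iff.1 (mem_interior_iff_mem_nhds.1 h)
  refine ⟨r, hr, fun x => ?_⟩
  by_contra! hx
  have hy : -(r / ‖x‖) • x ∈ convexHull ℝ T := by
    refine hsub ?_
    rw [mem_closedBall_zero_iff, norm_smul, norm_neg, norm_div, norm_norm, Real.norm_of_nonneg hr.le]
    rcases eq_or_ne ‖x‖ 0 with h0 | h0
    · simp [h0, hr.le]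
    · exact (div_mul_cancel₀ r h0).le
  have hlin : IsLinearMap ℝ fun a : Fin n → ℝ => a ⬝ᵥ x :=
    ⟨fun a b => add_dotProduct a b x, fun c a => smul_dotProduct c a x⟩
  have h1 : convexHull ℝ T ⊆ {a | -r * ‖x‖ < a ⬝ᵥ x} :=
    convexHull_min hx (convex_halfSpace_gt hlin _)
  have h2 : -r * ‖x‖ < (-(r / ‖x‖) • x) ⬝ᵥ x := h1 hy
  rw [smul_dotProduct, smul_eq_mul] at h2
  rcases eq_or_ne x 0 with rfl | hx0
  · simp at h2
  · have hpos : 0 < ‖x‖ := norm_pos_iff.2 hx0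
    have h3 := mul_le_mul_of_nonneg_left (norm_sq_le_dotProduct_self x) (div_nonneg hr.le hpos.le)
    have h4 : r / ‖x‖ * ‖x‖ ^ 2 = r * ‖x‖ := by field_simp
    linarith

/-- Existence for the scalar gradient inclusion with zero boundary values. -/
lemma exists_scalar_solution {n : ℕ} {F : Set (Fin n → ℝ)}
    (hF : (0 : Fin n → ℝ) ∈ interior (convexHull ℝ F)) {Ω : Set (Fin n → ℝ)} (hΩ : IsOpen Ω)
    (hne : Ω.Nonempty) :
    ∃ (v : (Fin n → ℝ) → ℝ) (K : ℝ≥0), LipschitzWith K v ∧ (∀ x ∉ Ω, v x = 0) ∧ 0 ≤ v ∧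
      (∃ x, v x ≠ 0) ∧
      ∀ᵐ x ∂(volume : Measure (Fin n → ℝ)), x ∈ Ω → ∃ a ∈ F, HasFDerivAt v (dotCLM a) x := by
  classical
  obtain ⟨T, hTF, hT⟩ := exists_finset_mem_interior_convexHull hF
  obtain ⟨ε, hε, hco⟩ := exists_coercive_of_zero_mem_interior hT
  obtain ⟨v, K, hv, hv0, hnn, hnz, hd⟩ := exists_lipschitz_hasFDerivAt_mem
    (T := T.image dotCLM) (μ := volume) hΩ hne hε fun x => by
      obtain ⟨a, ha, hax⟩ := hco x
      exact ⟨dotCLM a, Finset.mem_image_of_mem _ ha, by rwa [dotCLM_apply]⟩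
  refine ⟨v, K, hv, hv0, hnn, hnz, ?_⟩
  filter_upwards [hd] with x hx hxΩ
  obtain ⟨ℓ, hℓ, h⟩ := hx hxΩ
  obtain ⟨a, ha, rfl⟩ := Finset.mem_image.1 hℓ
  exact ⟨a, hTF ha, h⟩

lemma jac_smul_const {n : ℕ} {v : (Fin n → ℝ) → ℝ} {a x : Fin n → ℝ}
    (h : HasFDerivAt v (dotCLM a) x) (b : Fin n → ℝ) :
    jac (fun y => v y • b) x = Matrix.vecMulVec b a := by
  have h1 := h.smul_const b
  ext i j
  simp [jac, h1.fderiv, dotCLM_apply, Matrix.vecMulVec_apply, mul_comm]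

/-- The relative interior condition for the necessity part, in the case where `span E` is the range
of `symmOuter b` with `b` the mean of the field. -/
lemma zero_mem_interior_of_symmGrad_mem {n : ℕ} {u : (Fin n → ℝ) → (Fin n → ℝ)} {C : ℝ≥0}
    (hu : LipschitzWith C u) (hc : HasCompactSupport u) (hb : ∫ x, u x ≠ 0)
    {F : Set (Fin n → ℝ)}
    (h : ∀ᵐ x ∂(volume : Measure (Fin n → ℝ)), jac u x + (jac u x)ᵀ = 0 ∨
      ∃ a ∈ F, symmOuter (∫ x, u x) a = jac u x + (jac u x)ᵀ) :
    (0 : Fin n → ℝ) ∈ interior (convexHull ℝ F) := by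
  by_contra h0
  have : Nontrivial (Fin n → ℝ) := ⟨⟨_, _, hb⟩⟩
  obtain ⟨f, hf0, hf⟩ := exists_ne_zero_nonpos_of_zero_notMem_interior h0
  set c : Fin n → ℝ := fun i => f (Pi.single i 1) with hc_def
  have hfc : ∀ a, f a = c ⬝ᵥ a := by
    intro a
    rw [f.pi_apply_eq_sum_univ a]
    simp only [dotProduct, smul_eq_mul, hc_def]
    refine Finset.sum_congr rfl fun i _ => ?_
    rw [mul_comm]
    congr 2
    funext j
    simp [Pi.single_apply, eq_comm]
  obtain ⟨A, hA, hAb⟩ := exists_isSymm_mulVec_eq hb c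
  obtain ⟨hint, hzero⟩ := integral_frob_symmGrad hu hc hA
  have hnonpos : ∀ᵐ x ∂(volume : Measure (Fin n → ℝ)),
      0 ≤ -frob A (jac u x + (jac u x)ᵀ) := by
    filter_upwards [h] with x hx
    rcases hx with hx | ⟨a, ha, hx⟩
    · rw [hx]; simp [frob]
    · rw [← hx, frob_symmOuter hA, hAb, ← hfc]
      linarith [hf a ha]
  have hae := (integral_eq_zero_iff_of_nonneg_ae hnonpos hint.neg).1 (by
    rw [integral_neg, hzero, neg_zero])
  have hAb0 := mulVec_integral_eq_zero hu hc hA (by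
    filter_upwards [hae] with x hx
    simpa using hx)
  refine hf0 (LinearMap.ext fun a => ?_)
  rw [hfc, ← hAb, hAb0, zero_dotProduct, LinearMap.zero_apply]

/-- For `Ω ⊆ ℝⁿ` open, bounded, nonempty and `E ⊆ Sym(n) \ {0}` with
`dim span E = n`, there exists `u ∈ W₀^{1,∞}(Ω; ℝⁿ)` with `Du + (Du)ᵀ ∈ E` a.e. and
`∫_Ω u ≠ 0` iff `0 ∈ ri (co E)` and there is a nonzero `b ∈ ℝⁿ` with `A b = 0` for all
`A` in the orthogonal complement of `span E` inside the symmetric matrices. -/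
theorem stmt16 {n : ℕ} (Ω : Set (Fin n → ℝ)) (hΩo : IsOpen Ω)
    (hΩb : Bornology.IsBounded Ω) (hΩne : Ω.Nonempty)
    (E : Set (Matrix (Fin n) (Fin n) ℝ)) (hE : ∀ A ∈ E, A.IsSymm ∧ A ≠ 0)
    (hdim : Module.finrank ℝ (Submodule.span ℝ E) = n) :
    (∃ (u : (Fin n → ℝ) → (Fin n → ℝ)) (C : NNReal), LipschitzWith C u ∧
        (∀ x ∉ Ω, u x = 0) ∧
        (∀ᵐ x ∂(volume : Measure (Fin n → ℝ)), x ∈ Ω → jac u x + (jac u x)ᵀ ∈ E) ∧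
        (∫ x in Ω, u x) ≠ 0) ↔
      ((0 : Matrix (Fin n) (Fin n) ℝ) ∈ intrinsicInterior ℝ (convexHull ℝ E) ∧
        ∃ b : Fin n → ℝ, b ≠ 0 ∧
          ∀ A : Matrix (Fin n) (Fin n) ℝ, A.IsSymm → (∀ B ∈ E, frob A B = 0) →
            A.mulVec b = 0) := by
  have himage : ∀ b : Fin n → ℝ, b ≠ 0 →
      (∀ A : Matrix (Fin n) (Fin n) ℝ, A.IsSymm → (∀ B ∈ E, frob A B = 0) →
        A.mulVec b = 0) →
      symmOuter b '' (symmOuter b ⁻¹' E) = E ∧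
        Submodule.span ℝ (symmOuter b ⁻¹' E) = ⊤ := by
    intro b hb hA
    have hspan := span_eq_range_symmOuter (fun A hA => (hE A hA).1) hdim hb hA
    have himg : symmOuter b '' (symmOuter b ⁻¹' E) = E := by
      refine Set.image_preimage_eq_of_subset fun B hB => ?_
      have h : B ∈ LinearMap.range (symmOuter b) := hspan ▸ Submodule.subset_span hB
      exact h
    refine ⟨himg, Submodule.map_injective_of_injective (symmOuter_injective hb) ?_⟩
    rw [← Submodule.span_image, himg, hspan, Submodule.map_top]
  constructor
  · rintro ⟨u, C, hu, hu0, hjac, hint⟩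
    have hc : HasCompactSupport u :=
      HasCompactSupport.intro hΩb.isCompact_closure
        fun x hx => hu0 x fun h => hx (subset_closure h)
    rw [setIntegral_eq_integral_of_forall_compl_eq_zero hu0] at hint
    have hE' : ∀ᵐ x ∂(volume : Measure (Fin n → ℝ)),
        jac u x + (jac u x)ᵀ = 0 ∨ jac u x + (jac u x)ᵀ ∈ E := by
      filter_upwards [hjac, hu.ae_fderiv_eq_zero_of_eqOn_zero hΩo.measurableSet.compl hu0]
        with x hx hx0
      by_cases hxΩ : x ∈ Ω
      · exact Or.inr (hx hxΩ)
      · left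
        have : jac u x = 0 := by
          ext i j
          simp [jac, hx0 hxΩ]
        simp [this]
    have hA : ∀ A : Matrix (Fin n) (Fin n) ℝ, A.IsSymm → (∀ B ∈ E, frob A B = 0) →
        A.mulVec (∫ x, u x) = 0 := by
      intro A hA hAE
      refine mulVec_integral_eq_zero hu hc hA ?_
      filter_upwards [hE'] with x hx
      rcases hx with hx | hx
      · rw [hx]; simp [frob]
      · exact hAE _ hx
    refine ⟨?_, _, hint, hA⟩
    obtain ⟨himg, hspan⟩ := himage _ hint hA
    rw [← himg, zero_mem_intrinsicInterior_image_iff (symmOuter_injective hint) hspan]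
    refine zero_mem_interior_of_symmGrad_mem hu hc hint ?_
    filter_upwards [hE'] with x hx
    refine hx.imp_right fun h => ?_
    rw [← himg] at h
    exact h
  · rintro ⟨h0, b, hb, hA⟩
    obtain ⟨himg, hspan⟩ := himage b hb hA
    rw [← himg, zero_mem_intrinsicInterior_image_iff (symmOuter_injective hb) hspan] at h0
    obtain ⟨v, K, hv, hv0, hnn, ⟨x₀, hx₀⟩, hd⟩ := exists_scalar_solution h0 hΩo hΩne
    have hvc : HasCompactSupport v :=
      HasCompactSupport.intro hΩb.isCompact_closure
        fun x hx => hv0 x fun h => hx (subset_closure h)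
    have hpos := hv.continuous.integral_pos_of_hasCompactSupport_nonneg_nonzero
      (μ := volume) hvc hnn hx₀
    refine ⟨fun x => v x • b, _, (ContinuousLinearMap.toSpanSingleton ℝ b).lipschitz.comp hv,
      fun x hx => by simp [hv0 x hx], ?_, ?_⟩
    · filter_upwards [hd] with x hx hxΩ
      obtain ⟨a, ha, h⟩ := hx hxΩ
      rw [jac_smul_const h]
      exact ha
    · rw [integral_smul_const, setIntegral_eq_integral_of_forall_compl_eq_zero hv0]
      exact smul_ne_zero hpos.ne' hb
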